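/- Let C be a nonzero left R-submodule of R/R(x^n−1), where R = F_q[x;θ,Im], and let g ∈ R be a monic polynomial of smallest degree among all nonzero polynomials of degree less than n whose images lie in C. Then C is generated as a left R-module by the image of g, i.e., C = Rg/R(x^n−1). -/

import Mathlib

/-- A presentation of the skew polynomial ring `A[x;σ,δ]`: a ring `R` together with an
inclusion of constants `C : A →+* R` and an element `X` satisfying the commutation rule
`X * a = σ(a) * X + δ(a)`, such that every element of `R` is uniquely a left
`A`-linear combination of the powers of `X`. -/
structure SkewPolyRing (A : Type*) [Ring A] (σ : A →+* A) (δ : A → A)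
    (R : Type*) [Ring R] where
  /-- the inclusion of the coefficient ring -/
  C : A →+* R
  /-- the skew variable -/
  X : R
  comm : ∀ a : A, X * C a = C (σ a) * X + C (δ a)
  /-- the (unique) left coefficients of a skew polynomial -/
  coeff : R → (ℕ →₀ A)
  repr_eq : ∀ f : R, f = (coeff f).sum fun i a => C a * X ^ i
  coeff_mk : ∀ c : ℕ →₀ A, coeff (c.sum fun i a => C a * X ^ i) = c

namespace SkewPolyRing

variable {A : Type*} [Ring A] {σ : A →+* A} {δ : A → A} {R : Type*} [Ring R]

/-- The degree of a nonzero skew polynomial (junk value `0` for the zero polynomial). -/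
def deg (P : SkewPolyRing A σ δ R) (f : R) : ℕ := (P.coeff f).support.sup id

/-- `δ` is a `σ`-derivation: it is additive and satisfies the twisted Leibniz rule. -/
def IsDerivation (σ : A →+* A) (δ : A → A) : Prop :=
  (∀ a b : A, δ (a + b) = δ a + δ b) ∧ ∀ a b : A, δ (a * b) = δ a * b + σ a * δ b

end SkewPolyRing


namespace SkewPolyRing

variable {A : Type*} [Ring A] {σ : A →+* A} {δ : A → A} {R : Type*} [Ring R]

/-- A skew polynomial is monic if its leading coefficient is `1`. -/
def Monic (P : SkewPolyRing A σ δ R) (f : R) : Prop := P.coeff f (P.deg f) = 1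

end SkewPolyRing

namespace SkewPolyRing

variable {A : Type*} [Ring A] {σ : A →+* A} {δ : A → A} {R : Type*} [Ring R]

theorem IsDerivation.map_zero (h : IsDerivation σ δ) : δ 0 = 0 := by
  simpa using h.1 0 0

theorem coeff_eq_of_eq_sum (P : SkewPolyRing A σ δ R) {f : R} {c : ℕ →₀ A}
    (h : f = c.sum fun i a => P.C a * P.X ^ i) : P.coeff f = c := by
  rw [h, P.coeff_mk]

theorem coeff_zero (P : SkewPolyRing A σ δ R) : P.coeff 0 = 0 :=
  P.coeff_eq_of_eq_sum (by simp)

theorem coeff_C_mul_X_pow (P : SkewPolyRing A σ δ R) (a : A) (i : ℕ) :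
    P.coeff (P.C a * P.X ^ i) = Finsupp.single i a :=
  P.coeff_eq_of_eq_sum (by simp)

theorem coeff_add (P : SkewPolyRing A σ δ R) (f g : R) :
    P.coeff (f + g) = P.coeff f + P.coeff g := by
  apply P.coeff_eq_of_eq_sum
  rw [Finsupp.sum_add_index' (by simp) (by simp [add_mul]), ← P.repr_eq, ← P.repr_eq]

/-- The coefficients of a skew polynomial, as an additive map. -/
def coeffHom (P : SkewPolyRing A σ δ R) : R →+ (ℕ →₀ A) where
  toFun := P.coeff
  map_zero' := P.coeff_zero
  map_add' := P.coeff_add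

theorem coeff_sub (P : SkewPolyRing A σ δ R) (f g : R) :
    P.coeff (f - g) = P.coeff f - P.coeff g :=
  map_sub P.coeffHom f g

theorem eq_zero_of_coeff_eq_zero (P : SkewPolyRing A σ δ R) {f : R} (h : P.coeff f = 0) :
    f = 0 := by
  rw [P.repr_eq f, h, Finsupp.sum_zero_index]

theorem induction_on (P : SkewPolyRing A σ δ R) {p : R → Prop} (f : R) (zero : p 0)
    (add : ∀ f g, p f → p g → p (f + g)) (monomial : ∀ a i, p (P.C a * P.X ^ i)) : p f := by
  rw [P.repr_eq f]
  exact Finset.sum_induction _ p add zero fun i _ => monomial _ i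

theorem coeff_C_mul (P : SkewPolyRing A σ δ R) (a : A) (f : R) (i : ℕ) :
    P.coeff (P.C a * f) i = a * P.coeff f i := by
  induction f using P.induction_on with
  | zero => simp [coeff_zero]
  | add f g hf hg => simp [mul_add, coeff_add, hf, hg]
  | monomial b j =>
    rw [← mul_assoc, ← map_mul, coeff_C_mul_X_pow, coeff_C_mul_X_pow]
    by_cases h : j = i <;> simp [h]

theorem coeff_X_mul_succ (P : SkewPolyRing A σ δ R) (hδ : IsDerivation σ δ) (f : R) (i : ℕ) :
    P.coeff (P.X * f) (i + 1) = σ (P.coeff f i) + δ (P.coeff f (i + 1)) := by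
  induction f using P.induction_on with
  | zero => simp [coeff_zero, hδ.map_zero]
  | add f g hf hg =>
    simp only [mul_add, coeff_add, Finsupp.add_apply, hf, hg, map_add, hδ.1]
    abel
  | monomial b j =>
    rw [← mul_assoc, P.comm, add_mul, mul_assoc, ← pow_succ', coeff_add]
    simp only [coeff_C_mul_X_pow, Finsupp.add_apply, Finsupp.single_apply]
    congr 1
    · simp [apply_ite σ]
    · simp [apply_ite δ, hδ.map_zero]

theorem coeff_eq_zero_of_deg_lt (P : SkewPolyRing A σ δ R) {f : R} {i : ℕ} (h : P.deg f < i) :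
    P.coeff f i = 0 := by
  by_contra hi
  exact h.not_ge (Finset.le_sup (f := id) (Finsupp.mem_support_iff.2 hi))

theorem deg_lt_of_coeff_eq_zero (P : SkewPolyRing A σ δ R) {f : R} (hf : f ≠ 0) {d : ℕ}
    (h : ∀ i, d ≤ i → P.coeff f i = 0) : P.deg f < d := by
  obtain ⟨j, hj⟩ : ∃ j, P.coeff f j ≠ 0 := by
    by_contra! hz
    exact hf (P.eq_zero_of_coeff_eq_zero (Finsupp.ext hz))
  have hlt : ∀ i, P.coeff f i ≠ 0 → i < d := fun i hi => not_le.1 fun hdi => hi (h i hdi)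
  exact (Finset.sup_lt_iff (Nat.zero_lt_of_lt (hlt j hj))).2
    fun i hi => hlt i (Finsupp.mem_support_iff.1 hi)

theorem coeff_X_pow_mul_of_lt (P : SkewPolyRing A σ δ R) (hδ : IsDerivation σ δ) {g : R} (k : ℕ)
    {i : ℕ} (hi : P.deg g + k < i) : P.coeff (P.X ^ k * g) i = 0 := by
  induction k generalizing i with
  | zero => simpa using P.coeff_eq_zero_of_deg_lt hi
  | succ k ih =>
    obtain ⟨i, rfl⟩ := Nat.exists_eq_succ_of_ne_zero (Nat.ne_zero_of_lt hi)
    rw [pow_succ', mul_assoc, Nat.succ_eq_add_one, P.coeff_X_mul_succ hδ, ih (by lia),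
      ih (by lia), map_zero, hδ.map_zero, add_zero]

theorem Monic.coeff_X_pow_mul {P : SkewPolyRing A σ δ R} (hδ : IsDerivation σ δ) {g : R}
    (hg : P.Monic g) (k : ℕ) : P.coeff (P.X ^ k * g) (P.deg g + k) = 1 := by
  induction k with
  | zero => rwa [pow_zero, one_mul, add_zero]
  | succ k ih =>
    rw [pow_succ', mul_assoc, ← add_assoc, P.coeff_X_mul_succ hδ, ih,
      P.coeff_X_pow_mul_of_lt hδ k (Nat.lt_succ_self _), map_one, hδ.map_zero, add_zero]

/-- Right division by a monic skew polynomial. -/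
theorem Monic.exists_sub_mul_coeff_eq_zero {P : SkewPolyRing A σ δ R} (hδ : IsDerivation σ δ)
    {g : R} (hg : P.Monic g) (f : R) :
    ∃ q : R, ∀ i, P.deg g ≤ i → P.coeff (f - q * g) i = 0 := by
  suffices H : ∀ (k : ℕ) (f : R), (∀ i, P.deg g + k ≤ i → P.coeff f i = 0) →
      ∃ q : R, ∀ i, P.deg g ≤ i → P.coeff (f - q * g) i = 0 from
    H (P.deg f + 1) f fun i hi => P.coeff_eq_zero_of_deg_lt (by lia)
  intro k
  induction k with
  | zero => exact fun f hf => ⟨0, by simpa using hf⟩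
  | succ k ih =>
    intro f hf
    set s := P.C (P.coeff f (P.deg g + k)) * P.X ^ k with hs
    obtain ⟨q, hq⟩ := ih (f - s * g) fun i hi => by
      rw [coeff_sub, Finsupp.sub_apply, hs, mul_assoc, coeff_C_mul]
      rcases hi.eq_or_lt with rfl | hi
      · rw [hg.coeff_X_pow_mul hδ, mul_one, sub_self]
      · rw [hf i hi, P.coeff_X_pow_mul_of_lt hδ k hi, mul_zero, sub_zero]
    exact ⟨s + q, by simpa only [add_mul, sub_sub] using hq⟩

end SkewPolyRing

/-- A nonzero left `R`-submodule of `R/R(xⁿ-1)` is generated by (the image of) a monic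
polynomial of smallest degree among all nonzero polynomials of degree `< n` whose images
lie in it. -/
theorem submodule_eq_span_min_degree {F R : Type*} [Field F] [Fintype F] [Ring R]
    (θ : F ≃+* F) (Im : F → F) (hIm : SkewPolyRing.IsDerivation (θ : F →+* F) Im)
    (P : SkewPolyRing F (θ : F →+* F) Im R) (n : ℕ)
    (Csub : Submodule R (R ⧸ (Submodule.span R {P.X ^ n - 1} : Submodule R R)))
    (hC : Csub ≠ ⊥) (g : R) (hg0 : g ≠ 0) (hmonic : P.Monic g) (hdeg : P.deg g < n)
    (hmem : (Submodule.span R {P.X ^ n - 1} : Submodule R R).mkQ g ∈ Csub)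
    (hmin : ∀ f : R, f ≠ 0 → P.deg f < n →
      (Submodule.span R {P.X ^ n - 1} : Submodule R R).mkQ f ∈ Csub → P.deg g ≤ P.deg f) :
    Csub = (Submodule.span R {g}).map
      (Submodule.span R {P.X ^ n - 1} : Submodule R R).mkQ := by
  apply le_antisymm
  · intro y hy
    obtain ⟨f, rfl⟩ := Submodule.mkQ_surjective _ y
    obtain ⟨q, hq⟩ := hmonic.exists_sub_mul_coeff_eq_zero hIm f
    have hr : f - q * g = 0 := by
      by_contra hr
      have hlt := P.deg_lt_of_coeff_eq_zero hr hq
      refine (hmin _ hr (hlt.trans hdeg) ?_).not_gt hlt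
      rw [map_sub, ← smul_eq_mul, map_smul]
      exact Csub.sub_mem hy (Csub.smul_mem q hmem)
    exact Submodule.mem_map_of_mem
      (Submodule.mem_span_singleton.2 ⟨q, (sub_eq_zero.1 hr).symm⟩)
  · rw [Submodule.map_span_le]
    simpa using hmem
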